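/- There exists an oracle A ⊆ ℕ of hyperimmune-free degree that is weakly Kurtz engulfing. -/

import Mathlib

open Filter

namespace CichonAnalog

/-! ### Oracle computability -/

/-- Partial functions `ℕ →. ℕ` partial recursive relative to the oracle `A ⊆ ℕ`.
This is Mathlib's `Nat.Partrec` with an extra base case for the characteristic
function of the oracle. -/
inductive RecursiveIn (A : Set ℕ) : (ℕ →. ℕ) → Prop
  | zero : RecursiveIn A (pure 0)
  | succ : RecursiveIn A ↑Nat.succ
  | left : RecursiveIn A ↑fun n : ℕ => n.unpair.1
  | right : RecursiveIn A ↑fun n : ℕ => n.unpair.2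
  | oracle : RecursiveIn A ↑fun n : ℕ => A.indicator (fun _ => 1) n
  | pair {f g} : RecursiveIn A f → RecursiveIn A g →
      RecursiveIn A fun n => Nat.pair <$> f n <*> g n
  | comp {f g} : RecursiveIn A f → RecursiveIn A g →
      RecursiveIn A fun n => g n >>= f
  | prec {f g} : RecursiveIn A f → RecursiveIn A g →
      RecursiveIn A (Nat.unpaired fun a n =>
        n.rec (f a) fun y IH => do let i ← IH; g (Nat.pair a (Nat.pair y i)))
  | rfind {f} : RecursiveIn A f →
      RecursiveIn A fun a => Nat.rfind fun n => (fun m => m = 0) <$> f (Nat.pair a n)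

/-- The partial function `f` (between coded spaces) is partial recursive in the oracle `A`. -/
def PartrecIn (A : Set ℕ) {α σ : Type} [Primcodable α] [Primcodable σ] (f : α →. σ) : Prop :=
  RecursiveIn A fun n =>
    Part.bind ↑(Encodable.decode (α := α) n) fun a => (f a).map Encodable.encode

/-- `f ≤_T A` : the (total) function `f` is computable from the oracle `A`. -/
def ComputableIn (A : Set ℕ) {α σ : Type} [Primcodable α] [Primcodable σ] (f : α → σ) : Prop :=
  PartrecIn A (f : α →. σ)

/-- `W` is computably enumerable in the oracle `A`. -/
def CEIn (A : Set ℕ) {α : Type} [Primcodable α] (W : Set α) : Prop :=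
  ∃ f : α →. ℕ, PartrecIn A f ∧ ∀ a, a ∈ W ↔ (f a).Dom

/-- `W` is computably enumerable (unrelativized). -/
def CE {α : Type} [Primcodable α] (W : Set α) : Prop :=
  ∃ f : α →. ℕ, Partrec f ∧ ∀ a, a ∈ W ↔ (f a).Dom

/-! ### Cantor space, `Π⁰₁` classes, effective meagerness -/

/-- The basic clopen set (cylinder) of the finite binary string `σ` in Cantor space. -/
def Cyl (σ : List Bool) : Set (ℕ → Bool) :=
  {x | ∀ i, i < σ.length → x i = σ.getD i false}

/-- `P` is a `Π⁰₁(A)` class: a closed subset of Cantor space whose complement is the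
union of basic clopen sets over a set of strings c.e. in `A`. -/
def Pi01In (A : Set ℕ) (P : Set (ℕ → Bool)) : Prop :=
  ∃ W : Set (List Bool), CEIn A W ∧ P = (⋃ σ ∈ W, Cyl σ)ᶜ

/-- `P` is a (plain) `Π⁰₁` class. -/
def Pi01 (P : Set (ℕ → Bool)) : Prop :=
  ∃ W : Set (List Bool), CE W ∧ P = (⋃ σ ∈ W, Cyl σ)ᶜ

/-- `C` is a uniformly `Π⁰₁(A)` sequence of classes. -/
def UnifPi01In (A : Set ℕ) (C : ℕ → Set (ℕ → Bool)) : Prop :=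
  ∃ W : Set (ℕ × List Bool), CEIn A W ∧
    ∀ m, C m = (⋃ σ ∈ {s | (m, s) ∈ W}, Cyl σ)ᶜ

/-- `C` is a uniformly `Π⁰₁` sequence of classes. -/
def UnifPi01 (C : ℕ → Set (ℕ → Bool)) : Prop :=
  ∃ W : Set (ℕ × List Bool), CE W ∧
    ∀ m, C m = (⋃ σ ∈ {s | (m, s) ∈ W}, Cyl σ)ᶜ

/-- `S` is effectively meager relative to `A`: it is contained in the union of a
uniformly `Π⁰₁(A)` sequence of nowhere dense classes. -/
def EffMeagerIn (A : Set ℕ) (S : Set (ℕ → Bool)) : Prop :=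
  ∃ C : ℕ → Set (ℕ → Bool), UnifPi01In A C ∧ (∀ m, IsNowhereDense (C m)) ∧ S ⊆ ⋃ m, C m

/-- `S` is effectively meager (unrelativized). -/
def EffMeager (S : Set (ℕ → Bool)) : Prop :=
  ∃ C : ℕ → Set (ℕ → Bool), UnifPi01 C ∧ (∀ m, IsNowhereDense (C m)) ∧ S ⊆ ⋃ m, C m

/-- `A` is meager engulfing: some `A`-effectively meager set contains every
effectively meager set. -/
def MeagerEngulfing (A : Set ℕ) : Prop :=
  ∃ S, EffMeagerIn A S ∧ ∀ T, EffMeager T → T ⊆ S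

/-- `A` is weakly meager engulfing: some `A`-effectively meager set contains every
computable element of Cantor space. -/
def WeaklyMeagerEngulfing (A : Set ℕ) : Prop :=
  ∃ S, EffMeagerIn A S ∧ ∀ x : ℕ → Bool, Computable x → x ∈ S

/-- `V` is a computable set of finite binary strings. -/
def ComputableStringSet (V : Set (List Bool)) : Prop :=
  ∃ χ : List Bool → Bool, Computable χ ∧ ∀ s, s ∈ V ↔ χ s = true

/-- `V` is a dense set of finite binary strings: every string has an extension in `V`. -/
def DenseStringSet (V : Set (List Bool)) : Prop :=
  ∀ σ : List Bool, ∃ τ ∈ V, σ <+: τ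

/-- `x ∈ 2^ω` is weakly 1-generic: for every computable dense set `V` of finite
binary strings, some initial segment of `x` lies in `V`. -/
def Weakly1Generic (x : ℕ → Bool) : Prop :=
  ∀ V : Set (List Bool), ComputableStringSet V → DenseStringSet V →
    ∃ n, (List.ofFn fun i : Fin n => x i) ∈ V

/-! ### Domination properties -/

/-- `A` is high: `A` computes a function dominating every total computable function. -/
def High (A : Set ℕ) : Prop :=
  ∃ f : ℕ → ℕ, ComputableIn A f ∧
    ∀ g : ℕ → ℕ, Computable g → ∀ᶠ n in atTop, g n ≤ f n

/-- `A` is of hyperimmune degree: `A` computes a function not dominated by any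
computable function. -/
def HyperimmuneDegree (A : Set ℕ) : Prop :=
  ∃ f : ℕ → ℕ, ComputableIn A f ∧
    ∀ g : ℕ → ℕ, Computable g → ∃ᶠ n in atTop, g n < f n

/-- `A` is of hyperimmune-free degree: every function computable in `A` is dominated
by a total computable function. -/
def HyperimmuneFree (A : Set ℕ) : Prop :=
  ∀ f : ℕ → ℕ, ComputableIn A f →
    ∃ g : ℕ → ℕ, Computable g ∧ ∀ᶠ n in atTop, f n ≤ g n

/-! ### Measure on Cantor space, Kurtz and Schnorr tests -/

open scoped Classical in
/-- The uniform measure of the clopen set `⋃ σ ∈ F, [σ]` determined by the finite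
list `F` of binary strings: count the binary strings of maximal length extending
some member of `F`, and normalize. -/
noncomputable def listMeasure (F : List (List Bool)) : ℚ :=
  letI k := (F.map List.length).foldr max 0
  ((Finset.univ.filter fun v : Fin k → Bool =>
      ∃ σ ∈ F, σ <+: List.ofFn v).card : ℚ) / 2 ^ k

/-- The clopen subset of Cantor space given explicitly as a finite union of
basic clopen sets. -/
def ClopSet (F : List (List Bool)) : Set (ℕ → Bool) := ⋃ σ ∈ F, Cyl σ

/-- The effectively open subset of Cantor space enumerated by the sequence of
finite stages `g`. -/
def OpenSet (g : ℕ → List (List Bool)) : Set (ℕ → Bool) := ⋃ s, ClopSet (g s)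

/-- The measure of the open set enumerated by the stages `g`: the supremum of the
measures of its finite partial unions. -/
noncomputable def openMeasure (g : ℕ → List (List Bool)) : ℝ :=
  ⨆ s : ℕ, (listMeasure ((List.range (s + 1)).flatMap g) : ℝ)

/-- A Kurtz test relative to `A`: an `A`-computable sequence of explicitly given
clopen sets, the `m`-th of measure at most `2 ^ (-m)`. -/
def KurtzTestIn (A : Set ℕ) (G : ℕ → List (List Bool)) : Prop :=
  ComputableIn A G ∧ ∀ m, listMeasure (G m) ≤ (1 / 2) ^ m

/-- A (plain) Kurtz test. -/
def KurtzTest (G : ℕ → List (List Bool)) : Prop :=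
  Computable G ∧ ∀ m, listMeasure (G m) ≤ (1 / 2) ^ m

/-- A Schnorr test relative to `A`: an `A`-computable doubly indexed sequence of finite
stages such that the `m`-th effectively open set `⋃ s, ClopSet (g m s)` has measure at
most `2 ^ (-m)`, and this measure is a real computable in `A` uniformly in `m`. -/
def SchnorrTestIn (A : Set ℕ) (g : ℕ → ℕ → List (List Bool)) : Prop :=
  ComputableIn A (fun p : ℕ × ℕ => g p.1 p.2) ∧
  (∀ m, openMeasure (g m) ≤ (1 / 2) ^ m) ∧
  ∃ q : ℕ × ℕ → ℚ, ComputableIn A q ∧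
    ∀ m k, |openMeasure (g m) - (q (m, k) : ℝ)| ≤ (1 / 2) ^ k

/-- A (plain) Schnorr test. -/
def SchnorrTest (g : ℕ → ℕ → List (List Bool)) : Prop :=
  Computable (fun p : ℕ × ℕ => g p.1 p.2) ∧
  (∀ m, openMeasure (g m) ≤ (1 / 2) ^ m) ∧
  ∃ q : ℕ × ℕ → ℚ, Computable q ∧
    ∀ m k, |openMeasure (g m) - (q (m, k) : ℝ)| ≤ (1 / 2) ^ k

/-- `N` is Schnorr null relative to `A`. -/
def SchnorrNullIn (A : Set ℕ) (N : Set (ℕ → Bool)) : Prop :=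
  ∃ g, SchnorrTestIn A g ∧ N ⊆ ⋂ m, OpenSet (g m)

/-- `N` is Schnorr null (unrelativized). -/
def SchnorrNull (N : Set (ℕ → Bool)) : Prop :=
  ∃ g, SchnorrTest g ∧ N ⊆ ⋂ m, OpenSet (g m)

/-- `x ∈ 2^ω` is Schnorr random: it belongs to no Schnorr null set. -/
def SchnorrRandom (x : ℕ → Bool) : Prop := ∀ N, SchnorrNull N → x ∉ N

/-- `A` is Kurtz engulfing: there is an `A`-computable sequence of Kurtz tests relative
to `A` such that every Kurtz null set is contained in the null set of one of them. -/
def KurtzEngulfing (A : Set ℕ) : Prop :=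
  ∃ G : ℕ → ℕ → List (List Bool),
    ComputableIn A (fun p : ℕ × ℕ => G p.1 p.2) ∧
    (∀ i m, listMeasure (G i m) ≤ (1 / 2) ^ m) ∧
    ∀ L, KurtzTest L → ∃ i, (⋂ m, ClopSet (L m)) ⊆ ⋂ m, ClopSet (G i m)

/-- `A` is weakly Kurtz engulfing: there is an `A`-computable sequence of Kurtz tests
relative to `A` such that the union of their null sets contains every computable
element of Cantor space. -/
def WeaklyKurtzEngulfing (A : Set ℕ) : Prop :=
  ∃ G : ℕ → ℕ → List (List Bool),
    ComputableIn A (fun p : ℕ × ℕ => G p.1 p.2) ∧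
    (∀ i m, listMeasure (G i m) ≤ (1 / 2) ^ m) ∧
    ∀ x : ℕ → Bool, Computable x → ∃ i, x ∈ ⋂ m, ClopSet (G i m)

/-- `A` is weakly Schnorr engulfing: some set Schnorr null relative to `A` contains
every computable element of Cantor space. -/
def WeaklySchnorrEngulfing (A : Set ℕ) : Prop :=
  ∃ N, SchnorrNullIn A N ∧ ∀ x : ℕ → Bool, Computable x → x ∈ N

/-! ### DNR and PA degrees -/

/-- The `e`-th partial computable function. -/
noncomputable def phi (e : ℕ) : ℕ →. ℕ := (Denumerable.ofNat Nat.Partrec.Code e).eval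

/-- `h` is diagonally nonrecursive. -/
def DNRFun (h : ℕ → ℕ) : Prop := ∀ e, ∀ y ∈ phi e e, h e ≠ y

/-- `A` is DNR: `A` computes a diagonally nonrecursive function. -/
def DNRDegree (A : Set ℕ) : Prop := ∃ h : ℕ → ℕ, ComputableIn A h ∧ DNRFun h

/-- `A` is PA: `A` computes a `{0,1}`-valued diagonally nonrecursive function. -/
def PA (A : Set ℕ) : Prop :=
  ∃ h : ℕ → ℕ, ComputableIn A h ∧ (∀ e, h e ≤ 1) ∧ DNRFun h

/-! ### Traces -/

/-- The trace `σ` (satisfying `|σ n| ≤ n`) traces the function `f` if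
`f n ∈ σ n` for all but finitely many `n`. -/
def Traces (σ : ℕ → Finset ℕ) (f : ℕ → ℕ) : Prop := ∀ᶠ n in atTop, f n ∈ σ n

/-- `σ` is a `(D, g)`-trace relative to `A`: `D` is infinite and c.e. in `A`, `g` is a
partial `A`-computable function with `D ⊆ dom g` and `g n ≥ n` on its domain, and `σ`
is partial `A`-computable, defined on `D`, with `|σ n| < g n` for all `n ∈ D`. -/
def IsDGTraceIn (A : Set ℕ) (D : Set ℕ) (g : ℕ →. ℕ) (σ : ℕ →. Finset ℕ) : Prop :=
  D.Infinite ∧ CEIn A D ∧ PartrecIn A g ∧ D ⊆ g.Dom ∧ (∀ n, ∀ y ∈ g n, n ≤ y) ∧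
  PartrecIn A σ ∧ D ⊆ σ.Dom ∧ ∀ n ∈ D, ∀ S ∈ σ n, ∀ b ∈ g n, S.card < b

/-- `σ` is a `(D, g)`-trace (unrelativized). -/
def IsDGTrace (D : Set ℕ) (g : ℕ →. ℕ) (σ : ℕ →. Finset ℕ) : Prop :=
  D.Infinite ∧ CE D ∧ Partrec g ∧ D ⊆ g.Dom ∧ (∀ n, ∀ y ∈ g n, n ≤ y) ∧
  Partrec σ ∧ D ⊆ σ.Dom ∧ ∀ n ∈ D, ∀ S ∈ σ n, ∀ b ∈ g n, S.card < b

/-- The `(D, g)`-trace `σ` traces `f`: `f n ∈ σ n` for all but finitely many `n ∈ D`. -/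
def DGTraces (D : Set ℕ) (σ : ℕ →. Finset ℕ) (f : ℕ → ℕ) : Prop :=
  ∀ᶠ n in atTop, n ∈ D → ∀ S ∈ σ n, f n ∈ S

/-! ### Finite approximations of oracle computations -/

/-- The initial segment of length `n` of `Z`. -/
def initSeg (Z : ℕ → Bool) (n : ℕ) : List Bool := (List.range n).map Z

@[simp]
theorem length_initSeg (Z : ℕ → Bool) (n : ℕ) : (initSeg Z n).length = n := by
  simp [initSeg]

theorem getD_initSeg {Z : ℕ → Bool} {n i : ℕ} (h : i < n) : (initSeg Z n).getD i false = Z i := by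
  simp [initSeg, h]

theorem initSeg_succ (Z : ℕ → Bool) (n : ℕ) : initSeg Z (n + 1) = initSeg Z n ++ [Z n] := by
  simp [initSeg, List.range_succ]

theorem initSeg_congr {Z Z' : ℕ → Bool} {n : ℕ} (h : ∀ i < n, Z i = Z' i) :
    initSeg Z n = initSeg Z' n := by
  simpa [initSeg] using h

theorem isClopen_setOf_initSeg (T : List Bool → Prop) (n : ℕ) :
    IsClopen {Z : ℕ → Bool | T (initSeg Z n)} := by
  let r : (ℕ → Bool) → (Fin n → Bool) := fun Z i => Z i
  have hr : Continuous r := by fun_prop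
  have : {Z : ℕ → Bool | T (initSeg Z n)} = r ⁻¹' {v | T (List.ofFn v)} := by
    ext Z
    have : initSeg Z n = List.ofFn (r Z) := by
      apply List.ext_getElem <;> simp [initSeg, r]
    simp [this]
  rw [this]
  exact (isClopen_discrete _).preimage hr

/-- `u` approximates the partial function `f` along the oracle `Z`: every value that `u` produces
from an initial segment of `Z` is correct, and every value of `f` is produced from all
sufficiently long initial segments. -/
structure Approximates (Z : ℕ → Bool) (u : List Bool → ℕ → Option ℕ) (f : ℕ →. ℕ) : Prop where
  sound : ∀ n x y, u (initSeg Z n) x = some y → y ∈ f x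
  complete : ∀ x y, y ∈ f x → ∀ᶠ n in atTop, u (initSeg Z n) x = some y

theorem Approximates.of_total {Z : ℕ → Bool} (f : ℕ → ℕ) :
    Approximates Z (fun _ x => some (f x)) (f : ℕ →. ℕ) where
  sound n x y h := by simpa [eq_comm] using h
  complete x y h := by
    simp only [PFun.coe_val, Part.mem_some_iff] at h
    simp [h]

theorem Approximates.pair {Z : ℕ → Bool} {u v : List Bool → ℕ → Option ℕ} {f g : ℕ →. ℕ}
    (hf : Approximates Z u f) (hg : Approximates Z v g) :
    Approximates Z (fun σ x => (u σ x).bind fun a => (v σ x).map (Nat.pair a))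
      (fun n => Nat.pair <$> f n <*> g n) where
  sound n x y h := by
    simp only [Option.bind_eq_some_iff, Option.map_eq_some_iff] at h
    obtain ⟨a, ha, b, hb, rfl⟩ := h
    simp only [Seq.seq, Part.map_eq_map, Part.mem_bind_iff, Part.mem_map_iff]
    exact ⟨_, ⟨a, hf.sound _ _ _ ha, rfl⟩, b, hg.sound _ _ _ hb, rfl⟩
  complete x y h := by
    simp only [Seq.seq, Part.map_eq_map, Part.mem_bind_iff, Part.mem_map_iff] at h
    obtain ⟨_, ⟨a, ha, rfl⟩, b, hb, rfl⟩ := h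
    filter_upwards [hf.complete _ _ ha, hg.complete _ _ hb] with n h1 h2
    simp [h1, h2]

theorem Approximates.comp {Z : ℕ → Bool} {u v : List Bool → ℕ → Option ℕ} {f g : ℕ →. ℕ}
    (hf : Approximates Z u f) (hg : Approximates Z v g) :
    Approximates Z (fun σ x => (v σ x).bind (u σ)) (fun n => g n >>= f) where
  sound n x y h := by
    simp only [Option.bind_eq_some_iff] at h
    obtain ⟨a, ha, hb⟩ := h
    exact Part.mem_bind_iff.2 ⟨a, hg.sound _ _ _ ha, hf.sound _ _ _ hb⟩
  complete x y h := by
    obtain ⟨a, ha, hb⟩ := Part.mem_bind_iff.1 h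
    filter_upwards [hg.complete _ _ ha, hf.complete _ _ hb] with n h1 h2
    simp [h1, h2]

theorem Approximates.prec {Z : ℕ → Bool} {u v : List Bool → ℕ → Option ℕ} {f g : ℕ →. ℕ}
    (hf : Approximates Z u f) (hg : Approximates Z v g) :
    Approximates Z
      (fun σ x => Nat.rec (motive := fun _ => Option ℕ) (u σ x.unpair.1)
        (fun y IH => IH.bind fun i => v σ (Nat.pair x.unpair.1 (Nat.pair y i))) x.unpair.2)
      (Nat.unpaired fun a n =>
        n.rec (f a) fun y IH => do let i ← IH; g (Nat.pair a (Nat.pair y i))) where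
  sound n x y h := by
    simp only [Nat.unpaired]
    generalize x.unpair.1 = a at *
    generalize x.unpair.2 = k at *
    induction k generalizing y with
    | zero => exact hf.sound _ _ _ h
    | succ k ih =>
      simp only [Option.bind_eq_some_iff] at h
      obtain ⟨i, hi, h⟩ := h
      exact Part.mem_bind_iff.2 ⟨i, ih _ hi, hg.sound _ _ _ h⟩
  complete x y h := by
    simp only [Nat.unpaired] at h
    generalize x.unpair.1 = a at *
    generalize x.unpair.2 = k at *
    induction k generalizing y with
    | zero => exact hf.complete _ _ h
    | succ k ih =>
      obtain ⟨i, hi, h⟩ := Part.mem_bind_iff.1 h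
      filter_upwards [ih _ hi, hg.complete _ _ h] with n h1 h2
      simp [h1, h2]

/-- Starting from `0`, move on to the next number as long as `w` has a positive value at the
current one, for at most `n` steps. -/
def skipPos (w : ℕ → Option ℕ) (n : ℕ) : ℕ :=
  Nat.rec (motive := fun _ => ℕ) 0 (fun _ i => if 0 < (w i).getD 0 then i + 1 else i) n

theorem pos_of_lt_skipPos (w : ℕ → Option ℕ) (n : ℕ) :
    ∀ m < skipPos w n, 0 < (w m).getD 0 := by
  induction n with
  | zero => simp [skipPos]
  | succ n ih =>
    intro m hm
    change m < (if 0 < (w (skipPos w n)).getD 0 then skipPos w n + 1 else skipPos w n) at hm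
    split_ifs at hm with h
    · rcases Nat.lt_succ_iff_lt_or_eq.1 hm with h' | rfl
      exacts [ih m h', h]
    · exact ih m hm

theorem skipPos_eq_min {w : ℕ → Option ℕ} {y : ℕ} (h : ∀ m < y, 0 < (w m).getD 0)
    (hy : w y = some 0) (n : ℕ) : skipPos w n = min n y := by
  induction n with
  | zero => simp [skipPos]
  | succ n ih =>
    change (if 0 < (w (skipPos w n)).getD 0 then skipPos w n + 1 else skipPos w n) = _
    rw [ih]
    rcases lt_or_ge n y with hn | hn
    · rw [min_eq_left hn.le, if_pos (h n hn), min_eq_left hn]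
    · rw [min_eq_right hn, if_neg (by simp [hy]), min_eq_right (by lia)]

theorem Approximates.rfind {Z : ℕ → Bool} {u : List Bool → ℕ → Option ℕ} {f : ℕ →. ℕ}
    (hf : Approximates Z u f) :
    Approximates Z
      (fun σ a =>
        if u σ (Nat.pair a (skipPos (fun m => u σ (Nat.pair a m)) σ.length)) = some 0 then
          some (skipPos (fun m => u σ (Nat.pair a m)) σ.length) else none)
      (fun a => Nat.rfind fun n => (fun m => m = 0) <$> f (Nat.pair a n)) where
  sound n x y h := by
    simp only [Option.ite_none_right_eq_some, Option.some.injEq] at h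
    obtain ⟨h, rfl⟩ := h
    refine Nat.mem_rfind.2 ⟨?_, fun {m} hm => ?_⟩
    · exact (Part.mem_map_iff _).2 ⟨0, hf.sound _ _ _ h, by simp⟩
    have := pos_of_lt_skipPos _ _ m hm
    obtain ⟨k, hk⟩ : ∃ k, u (initSeg Z n) (Nat.pair x m) = some k := by
      by_contra! hne
      simp [Option.eq_none_iff_forall_ne_some.2 hne] at this
    rw [hk] at this
    exact (Part.mem_map_iff _).2 ⟨k, hf.sound _ _ _ hk, by simpa using Nat.pos_iff_ne_zero.1 this⟩
  complete x y h := by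
    obtain ⟨hmem, hlt⟩ := Nat.mem_rfind.1 h
    obtain ⟨z, hz, hz0⟩ := (Part.mem_map_iff _).1 hmem
    obtain rfl : z = 0 := by simpa using hz0
    have h1 : ∀ᶠ n in atTop, ∀ m < y, 0 < (u (initSeg Z n) (Nat.pair x m)).getD 0 := by
      refine (eventually_all_finite (Set.finite_lt_nat y)).2 fun m hm => ?_
      obtain ⟨k, hk, hk0⟩ := (Part.mem_map_iff _).1 (hlt hm)
      filter_upwards [hf.complete _ _ hk] with n hn
      rw [hn]
      exact Nat.pos_of_ne_zero (by simpa using hk0)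
    filter_upwards [h1, hf.complete _ _ hz, eventually_ge_atTop y] with n h1 h2 h3
    simp only [length_initSeg]
    rw [skipPos_eq_min h1 h2, min_eq_right h3, if_pos h2]

theorem primrec_skipPos {α : Type} [Primcodable α] {w : α → ℕ → Option ℕ} {n : α → ℕ}
    (hw : Primrec₂ w) (hn : Primrec n) : Primrec fun a => skipPos (w a) (n a) := by
  unfold skipPos
  refine Primrec.nat_rec' (h := fun a q => if 0 < (w a q.2).getD 0 then q.2 + 1 else q.2) hn
    (Primrec.const 0) (.mk (Primrec.ite ?_ ?_ ?_))
  · exact Primrec.nat_lt.comp (Primrec.const 0) (Primrec.option_getD.comp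
      (hw.comp Primrec.fst (Primrec.snd.comp Primrec.snd)) (Primrec.const 0))
  · exact Primrec.succ.comp (Primrec.snd.comp Primrec.snd)
  · exact Primrec.snd.comp Primrec.snd

/-- The Boolean characteristic function of an oracle. -/
noncomputable def charBool (A : Set ℕ) (n : ℕ) : Bool :=
  open Classical in decide (n ∈ A)

theorem RecursiveIn.of_eq {A : Set ℕ} {f g : ℕ →. ℕ} (hf : RecursiveIn A f)
    (h : ∀ n, f n = g n) : RecursiveIn A g :=
  funext h ▸ hf

/-- Normal form: a partial function recursive in `A` is approximated along `A` by a primitive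
recursive function. -/
theorem RecursiveIn.exists_approximates {A : Set ℕ} {f : ℕ →. ℕ} (hf : RecursiveIn A f) :
    ∃ u : List Bool → ℕ → Option ℕ, Primrec₂ u ∧ Approximates (charBool A) u f := by
  have pairA : Primrec₂ Nat.pair := Primrec₂.natPair
  induction hf with
  | zero =>
    exact ⟨_, Primrec₂.const (some 0), Approximates.of_total fun _ => 0⟩
  | succ => exact ⟨_, .mk (Primrec.option_some.comp (Primrec.succ.comp Primrec.snd)), .of_total _⟩
  | left =>
    exact ⟨_, .mk (Primrec.option_some.comp (Primrec.fst.comp (Primrec.unpair.comp Primrec.snd))),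
      .of_total _⟩
  | right =>
    exact ⟨_, .mk (Primrec.option_some.comp (Primrec.snd.comp (Primrec.unpair.comp Primrec.snd))),
      .of_total _⟩
  | oracle =>
    refine ⟨fun σ x => σ[x]?.map fun b => bif b then 1 else 0, ?_, ?_, ?_⟩
    · exact Primrec.option_map Primrec.list_getElem? (Primrec.cond Primrec.snd (Primrec.const 1)
        (Primrec.const 0))
    · intro n x y h
      simp only [initSeg, List.getElem?_map, Option.map_eq_some_iff] at h
      obtain ⟨b, ⟨c, hc, rfl⟩, rfl⟩ := h
      obtain ⟨-, rfl⟩ : x < n ∧ x = c := by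
        simpa [List.getElem?_eq_some_iff] using hc
      by_cases hx : x ∈ A <;> simp [charBool, hx, Part.one_def, Part.zero_def]
    · intro x y h
      filter_upwards [eventually_gt_atTop x] with n hn
      by_cases hx : x ∈ A
      · obtain rfl : y = 1 := by simpa [hx, Part.one_def] using h
        simp [initSeg, hn, charBool, hx]
      · obtain rfl : y = 0 := by simpa [hx, Part.zero_def] using h
        simp [initSeg, hn, charBool, hx]
  | pair _ _ ihf ihg =>
    obtain ⟨u, hu, hf⟩ := ihf
    obtain ⟨v, hv, hg⟩ := ihg
    refine ⟨_, ?_, hf.pair hg⟩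
    exact Primrec.option_bind hu (Primrec.option_map (hv.comp (Primrec.fst.comp Primrec.fst)
      (Primrec.snd.comp Primrec.fst)) (pairA.comp (Primrec.snd.comp Primrec.fst) Primrec.snd))
  | comp _ _ ihf ihg =>
    obtain ⟨u, hu, hf⟩ := ihf
    obtain ⟨v, hv, hg⟩ := ihg
    refine ⟨_, ?_, hf.comp hg⟩
    exact Primrec.option_bind hv (hu.comp (Primrec.fst.comp Primrec.fst) Primrec.snd)
  | prec _ _ ihf ihg =>
    obtain ⟨u, hu, hf⟩ := ihf
    obtain ⟨v, hv, hg⟩ := ihg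
    refine ⟨_, ?_, hf.prec hg⟩
    have hx : Primrec fun p : List Bool × ℕ => p.2.unpair := Primrec.unpair.comp Primrec.snd
    refine .mk <| Primrec.nat_rec' (h := fun p q => q.2.bind fun i =>
      v p.1 (Nat.pair p.2.unpair.1 (Nat.pair q.1 i))) (Primrec.snd.comp hx)
      (hu.comp Primrec.fst (Primrec.fst.comp hx)) ?_
    refine .mk <| Primrec.option_bind (Primrec.snd.comp Primrec.snd) ?_
    refine hv.comp (Primrec.fst.comp (Primrec.fst.comp Primrec.fst)) (pairA.comp
      (Primrec.fst.comp (hx.comp (Primrec.fst.comp Primrec.fst)))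
      (pairA.comp (Primrec.fst.comp (Primrec.snd.comp Primrec.fst)) Primrec.snd))
  | rfind _ ihf =>
    obtain ⟨u, hu, hf⟩ := ihf
    refine ⟨_, ?_, hf.rfind⟩
    have hs : Primrec fun p : List Bool × ℕ =>
        skipPos (fun m => u p.1 (Nat.pair p.2 m)) p.1.length :=
      primrec_skipPos (hu.comp (Primrec.fst.comp Primrec.fst)
        (pairA.comp (Primrec.snd.comp Primrec.fst) Primrec.snd))
        (Primrec.list_length.comp Primrec.fst)
    exact Primrec.ite (Primrec.eq.comp (hu.comp Primrec.fst (pairA.comp Primrec.snd hs))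
      (Primrec.const (some 0))) (Primrec.option_some.comp hs) (Primrec.const none)

/-! ### The hyperimmune-free basis theorem -/

/-- The closed set of sequences all of whose initial segments satisfy `T`. -/
def pathSet (T : List Bool → Prop) : Set (ℕ → Bool) := {Z | ∀ n, T (initSeg Z n)}

theorem isClosed_pathSet (T : List Bool → Prop) : IsClosed (pathSet T) := by
  simp only [pathSet, Set.ofPred_forall]
  exact isClosed_iInter fun n => (isClopen_setOf_initSeg T n).isClosed

theorem primrecPred_exists_lt {β : Type} [Primcodable β] {R : ℕ → β → Prop} {n : β → ℕ}
    (hR : PrimrecRel R) (hn : Primrec n) : PrimrecPred fun b => ∃ x < n b, R x b :=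
  (hR.exists_mem_list.comp (Primrec.list_range.comp hn) Primrec.id).of_eq fun b => by simp

theorem primrecPred_forall_lt {β : Type} [Primcodable β] {R : ℕ → β → Prop} {n : β → ℕ}
    (hR : PrimrecRel R) (hn : Primrec n) : PrimrecPred fun b => ∀ x < n b, R x b :=
  (hR.forall_mem_list.comp (Primrec.list_range.comp hn) Primrec.id).of_eq fun b => by simp

theorem primrec_testBit : Primrec₂ Nat.testBit := by
  have hpow : Primrec fun i : ℕ => 2 ^ i :=
    (Primrec₂.unpaired'.1 Nat.Primrec.pow).comp (Primrec.const 2) Primrec.id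
  have : PrimrecRel fun n i : ℕ => n / 2 ^ i % 2 = 1 :=
    Primrec.eq.comp (Primrec.nat_mod.comp (Primrec.nat_div.comp Primrec.fst
      (hpow.comp Primrec.snd)) (Primrec.const 2)) (Primrec.const 1)
  exact this.decide.of_eq fun n i => Nat.testBit_eq_decide_div_mod_eq.symm

theorem primrec_initSeg_testBit : Primrec₂ fun N k : ℕ => initSeg N.testBit k :=
  .mk <| Primrec.list_map (Primrec.list_range.comp Primrec.snd)
    (primrec_testBit.comp (Primrec.fst.comp Primrec.fst) Primrec.snd)

theorem exists_computable_bound {T : List Bool → Prop} {u : List Bool → ℕ → Option ℕ}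
    (hT : PrimrecPred T) (hu : Primrec₂ u)
    (h : ∀ Z ∈ pathSet T, ∀ x, ∃ n, u (initSeg Z n) x ≠ none) :
    ∃ g : ℕ → ℕ, Computable g ∧
      ∀ Z ∈ pathSet T, ∀ x, ∃ n, ∃ y ≤ g x, u (initSeg Z n) x = some y := by
  let E : List Bool → ℕ → ℕ → Prop := fun σ x s => ¬ T σ ∨ (u σ x ≠ none ∧ (u σ x).getD 0 ≤ s)
  let Q : ℕ → ℕ → Prop := fun x s => ∀ N < 2 ^ s, ∃ k < s + 1, E (initSeg N.testBit k) x s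
  have hE : PrimrecRel fun k (p : ℕ × ℕ × ℕ) => E (initSeg p.1.testBit k) p.2.1 p.2.2 := by
    have hσ : Primrec fun p : ℕ × ℕ × ℕ × ℕ => initSeg p.2.1.testBit p.1 :=
      primrec_initSeg_testBit.comp (Primrec.fst.comp Primrec.snd) Primrec.fst
    have hx : Primrec fun p : ℕ × ℕ × ℕ × ℕ => u (initSeg p.2.1.testBit p.1) p.2.2.1 :=
      hu.comp hσ (Primrec.fst.comp (Primrec.snd.comp Primrec.snd))
    refine (hT.comp hσ).not.or ((Primrec.eq.comp hx (Primrec.const none)).not.and ?_)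
    exact Primrec.nat_le.comp (Primrec.option_getD.comp hx (Primrec.const 0))
      (Primrec.snd.comp (Primrec.snd.comp Primrec.snd))
  have hQ : PrimrecRel Q := by
    have h1 : PrimrecRel fun (N : ℕ) (q : ℕ × ℕ) =>
        ∃ k < q.2 + 1, E (initSeg N.testBit k) q.1 q.2 :=
      primrecPred_exists_lt hE (Primrec.succ.comp (Primrec.snd.comp Primrec.snd))
    have hpow : Primrec fun i : ℕ => 2 ^ i :=
      (Primrec₂.unpaired'.1 Nat.Primrec.pow).comp (Primrec.const 2) Primrec.id
    exact primrecPred_forall_lt h1 (hpow.comp Primrec.snd)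
  have hcover : ∀ x, ∃ s, ∀ Z : ℕ → Bool, ∃ k < s + 1, E (initSeg Z k) x s := by
    intro x
    let U : ℕ → Set (ℕ → Bool) := fun s => {Z | ∃ k < s + 1, E (initSeg Z k) x s}
    have hmono : Monotone U := by
      rintro s t hst Z ⟨k, hk, hZ⟩
      exact ⟨k, by lia, hZ.imp_right fun h => ⟨h.1, h.2.trans hst⟩⟩
    have hopen : ∀ s, IsOpen (U s) := fun s => by
      have : U s = ⋃ k ∈ Set.Iio (s + 1), {Z | E (initSeg Z k) x s} := by
        ext Z; simp [U]
      rw [this]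
      exact isOpen_biUnion fun k _ => (isClopen_setOf_initSeg (E · x s) k).isOpen
    have hunion : ∀ Z, ∃ s, Z ∈ U s := fun Z => by
      by_cases hZ : Z ∈ pathSet T
      · obtain ⟨n, hn⟩ := h Z hZ x
        exact ⟨max n ((u (initSeg Z n) x).getD 0), n, by lia, .inr ⟨hn, le_max_right _ _⟩⟩
      · simp only [pathSet, Set.mem_ofPred_eq, not_forall] at hZ
        obtain ⟨n, hn⟩ := hZ
        exact ⟨n, n, by lia, .inl hn⟩
    obtain ⟨s, hs⟩ := isCompact_univ.elim_directed_cover U hopen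
      (fun Z _ => Set.mem_iUnion.2 (hunion Z)) hmono.directed_le
    exact ⟨s, fun Z => hs (Set.mem_univ Z)⟩
  have hQex : ∀ x, ∃ s, Q x s := fun x => (hcover x).imp fun s hs N _ => hs _
  classical
  refine ⟨fun x => Nat.find (hQex x), ?_, fun Z hZ x => ?_⟩
  · have hp : Partrec fun x => Nat.rfind fun s => Part.some (decide (Q x s)) :=
      Partrec.rfind (hQ.decide.to_comp.partrec)
    refine hp.of_eq_tot fun x => Nat.mem_rfind.2 ⟨?_, fun {m} hm => ?_⟩
    · simpa using Nat.find_spec (hQex x)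
    · simpa using Nat.find_min (hQex x) hm
  · have hQs : Q x (Nat.find (hQex x)) := Nat.find_spec (hQex x)
    beta_reduce
    generalize Nat.find (hQex x) = s at hQs ⊢
    obtain ⟨k, hk, hEk⟩ := hQs (Nat.ofBits fun i : Fin s => Z i) (Nat.ofBits_lt_two_pow _)
    rw [initSeg_congr (Z' := Z) fun i hi => Nat.testBit_ofBits_lt _ i (by lia)] at hEk
    obtain ⟨hne, hle⟩ := hEk.resolve_left (not_not.2 (hZ k))
    obtain ⟨y, hy⟩ := Option.ne_none_iff_exists'.1 hne
    exact ⟨k, y, by simpa [hy] using hle, hy⟩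

/-- Either totality of the functional approximated by `u` can be prevented on a nonempty subclass,
or the values of the functional on the class have a computable bound. -/
theorem exists_refinement {T : List Bool → Prop} {u : List Bool → ℕ → Option ℕ}
    (hT : PrimrecPred T) (hne : (pathSet T).Nonempty) (hu : Primrec₂ u) :
    ∃ T' : List Bool → Prop, PrimrecPred T' ∧ (pathSet T').Nonempty ∧ pathSet T' ⊆ pathSet T ∧
      ((∃ x, ∀ Z ∈ pathSet T', ∀ n, u (initSeg Z n) x = none) ∨
        ∃ g : ℕ → ℕ, Computable g ∧
          ∀ Z ∈ pathSet T', ∀ x, ∃ n, ∃ y ≤ g x, u (initSeg Z n) x = some y) := by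
  by_cases h : ∀ Z ∈ pathSet T, ∀ x, ∃ n, u (initSeg Z n) x ≠ none
  · exact ⟨T, hT, hne, subset_rfl, .inr (exists_computable_bound hT hu h)⟩
  · push Not at h
    obtain ⟨Z, hZ, x, hx⟩ := h
    refine ⟨fun σ => T σ ∧ u σ x = none, ?_, ⟨Z, fun n => ⟨hZ n, hx n⟩⟩, fun Z hZ n => (hZ n).1,
      .inl ⟨x, fun Z hZ n => (hZ n).2⟩⟩
    exact hT.and (Primrec.eq.comp (hu.comp Primrec.id (Primrec.const x)) (Primrec.const none))

theorem countable_setOf_primrec₂ : {u : List Bool → ℕ → Option ℕ | Primrec₂ u}.Countable := by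
  let J : (List Bool → ℕ → Option ℕ) → ℕ →. ℕ := fun u n =>
    Part.some (Encodable.encode ((Encodable.decode (α := List Bool × ℕ) n).map fun p => u p.1 p.2))
  have hJ : Function.Injective J := by
    intro u v huv
    funext σ x
    have := congrFun huv (Encodable.encode (σ, x))
    simpa [J] using this
  refine ((Set.countable_range Nat.Partrec.Code.eval).preimage_of_injOn hJ.injOn).mono ?_
  intro u hu
  have hprim : Nat.Primrec fun n => Encodable.encode
    ((Encodable.decode (α := List Bool × ℕ) n).map fun p => u p.1 p.2) := hu
  exact Nat.Partrec.Code.exists_code.1 (Nat.Partrec.of_primrec hprim)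

theorem charBool_setOf (Z : ℕ → Bool) : charBool {n | Z n = true} = Z := by
  funext n
  simp [charBool]

/-- The values of a total function recursive in `A` are bounded computably as soon as some
approximation to it is. -/
theorem hyperimmuneFree_of_forall {A : Set ℕ}
    (h : ∀ u : List Bool → ℕ → Option ℕ, Primrec₂ u →
      (∃ x, ∀ n, u (initSeg (charBool A) n) x = none) ∨
        ∃ g : ℕ → ℕ, Computable g ∧
          ∀ x, ∃ n, ∃ y ≤ g x, u (initSeg (charBool A) n) x = some y) :
    HyperimmuneFree A := by
  intro f hf
  have hf' : RecursiveIn A (f : ℕ →. ℕ) := by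
    exact RecursiveIn.of_eq hf fun n => by simp
  obtain ⟨u, hu, happ⟩ := hf'.exists_approximates
  obtain ⟨x, hx⟩ | ⟨g, hg, hbound⟩ := h u hu
  · obtain ⟨n, hn⟩ := (happ.complete x (f x) (Part.mem_some _)).exists
    simp [hx] at hn
  · refine ⟨g, hg, .of_forall fun x => ?_⟩
    obtain ⟨n, y, hy, hn⟩ := hbound x
    obtain rfl := Part.mem_some_iff.1 (happ.sound _ _ _ hn)
    exact hy

/-- The hyperimmune-free basis theorem. -/
theorem exists_hyperimmuneFree_mem_pathSet {T : List Bool → Prop} (hT : PrimrecPred T)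
    (hne : (pathSet T).Nonempty) : ∃ A : Set ℕ, charBool A ∈ pathSet T ∧ HyperimmuneFree A := by
  obtain ⟨e, he⟩ := countable_setOf_primrec₂.exists_eq_range ⟨fun _ _ => none, Primrec₂.const _⟩
  have hprim : ∀ i, Primrec₂ (e i) := fun i => by
    have : e i ∈ Set.range e := ⟨i, rfl⟩
    rwa [← he] at this
  let C := {T : List Bool → Prop // PrimrecPred T ∧ (pathSet T).Nonempty}
  have hstep : ∀ (i : ℕ) (S : C), ∃ S' : C, pathSet S'.1 ⊆ pathSet S.1 ∧
      ((∃ x, ∀ Z ∈ pathSet S'.1, ∀ n, e i (initSeg Z n) x = none) ∨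
        ∃ g : ℕ → ℕ, Computable g ∧
          ∀ Z ∈ pathSet S'.1, ∀ x, ∃ n, ∃ y ≤ g x, e i (initSeg Z n) x = some y) := by
    rintro i ⟨S, hS, hSne⟩
    obtain ⟨S', h1, h2, h3⟩ := exists_refinement hS hSne (hprim i)
    exact ⟨⟨S', h1, h2⟩, h3⟩
  choose next hsub hnext using hstep
  let S : ℕ → C := fun n => Nat.rec ⟨T, hT, hne⟩ (fun i S => next i S) n
  obtain ⟨Z, hZ⟩ := IsCompact.nonempty_iInter_of_sequence_nonempty_isCompact_isClosed
    (fun n => pathSet (S n).1) (fun n => hsub n (S n)) (fun n => (S n).2.2)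
    (isClosed_pathSet _).isCompact (fun n => isClosed_pathSet _)
  rw [Set.mem_iInter] at hZ
  refine ⟨{n | Z n = true}, by rw [charBool_setOf]; exact hZ 0,
    hyperimmuneFree_of_forall fun u hu => ?_⟩
  obtain ⟨i, rfl⟩ : u ∈ Set.range e := he ▸ hu
  rw [charBool_setOf]
  exact (hnext i (S i)).imp (fun ⟨x, hx⟩ => ⟨x, hx Z (hZ (i + 1))⟩)
    fun ⟨g, hg, hb⟩ => ⟨g, hg, hb Z (hZ (i + 1))⟩

/-! ### A class of sequences whose columns include all computable sequences -/

open Nat.Partrec (Code)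

/-- `σ` does not contradict the values of any partial computable function that are seen to
converge within `σ.length` steps; the bit at `⟨e, k⟩` stands for the value of the `e`-th
function at `k`. -/
def Coherent (σ : List Bool) : Prop :=
  ∀ j < σ.length, Code.evaln σ.length (Denumerable.ofNat Code j.unpair.1) j.unpair.2 ≠
    some (bif σ.getD j false then 0 else 1)

theorem primrecPred_coherent : PrimrecPred Coherent := by
  have h : PrimrecRel fun (j : ℕ) (σ : List Bool) =>
      Code.evaln σ.length (Denumerable.ofNat Code j.unpair.1) j.unpair.2 ≠
        some (bif σ.getD j false then 0 else 1) := by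
    have hj : Primrec fun p : ℕ × List Bool => p.1.unpair := Primrec.unpair.comp Primrec.fst
    refine (Primrec.eq.comp (Code.primrec_evaln.comp (((Primrec.list_length.comp Primrec.snd).pair
      ((Primrec.ofNat Code).comp (Primrec.fst.comp hj))).pair (Primrec.snd.comp hj))) ?_).not
    exact Primrec.option_some.comp (Primrec.cond ((Primrec.list_getD false).comp Primrec.snd
      Primrec.fst) (Primrec.const 0) (Primrec.const 1))
  exact primrecPred_forall_lt h Primrec.list_length

theorem nonempty_pathSet_coherent : (pathSet Coherent).Nonempty := by
  classical
  refine ⟨fun j => decide (1 ∈ (Denumerable.ofNat Code j.unpair.1).eval j.unpair.2),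
    fun n j hj heq => ?_⟩
  rw [length_initSeg] at hj
  have hev := Code.evaln_sound heq
  rw [getD_initSeg hj] at hev
  by_cases h1 : 1 ∈ (Denumerable.ofNat Code j.unpair.1).eval j.unpair.2
  · simp only [h1, decide_true, cond_true] at hev
    exact absurd (Part.mem_unique h1 hev) one_ne_zero
  · simp only [h1, decide_false, cond_false] at hev

theorem exists_column_eq {Z : ℕ → Bool} (hZ : Z ∈ pathSet Coherent) {x : ℕ → Bool}
    (hx : Computable x) : ∃ i, ∀ k, Z (Nat.pair i k) = x k := by
  have hx' : Nat.Partrec fun n => Part.some (Encodable.encode (x n)) := by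
    have : Partrec fun n => Part.some (Encodable.encode (x n)) := Computable.encode.comp hx
    exact Partrec.nat_iff.1 this
  obtain ⟨c, hc⟩ := Code.exists_code.1 hx'
  refine ⟨Encodable.encode c, fun k => ?_⟩
  have hmem : Encodable.encode (x k) ∈ c.eval k := by simp [hc]
  obtain ⟨s, hs⟩ := Code.evaln_complete.1 hmem
  set j := Nat.pair (Encodable.encode c) k with hj
  have h := hZ (max s (j + 1)) j (by simp)
  rw [length_initSeg, getD_initSeg (by lia)] at h
  simp only [hj, Nat.unpair_pair, Denumerable.ofNat_encode] at h
  rw [Code.evaln_mono (le_max_left _ _) hs] at h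
  revert h
  cases Z j <;> cases x k <;> simp

/-! ### Computability of the columns of an oracle -/

theorem RecursiveIn.of_partrec {A : Set ℕ} {f : ℕ →. ℕ} (hf : Nat.Partrec f) :
    RecursiveIn A f := by
  induction hf with
  | zero => exact .zero
  | succ => exact .succ
  | left => exact .left
  | right => exact .right
  | pair _ _ ihf ihg => exact .pair ihf ihg
  | comp _ _ ihf ihg => exact .comp ihf ihg
  | prec _ _ ihf ihg => exact .prec ihf ihg
  | rfind _ ihf => exact .rfind ihf

theorem RecursiveIn.of_primrec {A : Set ℕ} {f : ℕ → ℕ} (hf : Primrec f) :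
    RecursiveIn A (f : ℕ →. ℕ) :=
  .of_partrec (Nat.Partrec.of_primrec (Primrec.nat_iff.1 hf))

theorem RecursiveIn.comp_total {A : Set ℕ} {f g : ℕ → ℕ} (hf : RecursiveIn A (f : ℕ →. ℕ))
    (hg : RecursiveIn A (g : ℕ →. ℕ)) :
    RecursiveIn A ((fun n => f (g n) : ℕ → ℕ) : ℕ →. ℕ) := by
  exact (hf.comp hg).of_eq fun n => Part.bind_some (g n) (f : ℕ →. ℕ)

theorem RecursiveIn.pair_total {A : Set ℕ} {f g : ℕ → ℕ} (hf : RecursiveIn A (f : ℕ →. ℕ))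
    (hg : RecursiveIn A (g : ℕ →. ℕ)) :
    RecursiveIn A ((fun n => Nat.pair (f n) (g n) : ℕ → ℕ) : ℕ →. ℕ) := by
  exact (hf.pair hg).of_eq fun n => by simp [Seq.seq]

theorem RecursiveIn.prec_total {A : Set ℕ} {f g : ℕ → ℕ} (hf : RecursiveIn A (f : ℕ →. ℕ))
    (hg : RecursiveIn A (g : ℕ →. ℕ)) :
    RecursiveIn A ((fun n => Nat.rec (motive := fun _ => ℕ) (f n.unpair.1)
      (fun y IH => g (Nat.pair n.unpair.1 (Nat.pair y IH))) n.unpair.2 : ℕ → ℕ) : ℕ →. ℕ) := by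
  refine (hf.prec hg).of_eq fun n => ?_
  simp only [PFun.coe_val, Nat.unpaired]
  induction n.unpair.2 with
  | zero => rfl
  | succ k ih =>
    simp only [ih]
    exact Part.bind_some _ _

/-- The initial segment of length `m` of the `i`-th column of the oracle `A`. -/
noncomputable def columnSeg (A : Set ℕ) (i m : ℕ) : List Bool :=
  initSeg (fun k => charBool A (Nat.pair i k)) m

theorem computableIn_columnSeg (A : Set ℕ) :
    ComputableIn A fun p : ℕ × ℕ => [columnSeg A p.1 p.2] := by
  let o : ℕ → ℕ := fun n => A.indicator (fun _ => 1) n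
  let app : ℕ → ℕ := fun w => Encodable.encode
    (((Encodable.decode (α := List Bool) w.unpair.1.unpair.2.unpair.2).getD []) ++
      [decide (w.unpair.2 = 1)])
  let idx : ℕ → ℕ := fun w => Nat.pair w.unpair.1 w.unpair.2.unpair.1
  let single : ℕ → ℕ := fun w => Encodable.encode [(Encodable.decode (α := List Bool) w).getD []]
  have happ : Primrec app := by
    have h1 : Primrec fun w : ℕ => w.unpair.1.unpair.2.unpair.2 :=
      Primrec.snd.comp (Primrec.unpair.comp (Primrec.snd.comp (Primrec.unpair.comp
        (Primrec.fst.comp Primrec.unpair))))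
    exact Primrec.encode.comp (Primrec.list_concat.comp
      (Primrec.option_getD.comp (Primrec.decode.comp h1) (Primrec.const []))
      (PrimrecPred.decide (Primrec.eq.comp (Primrec.snd.comp Primrec.unpair) (Primrec.const 1))))
  have hidx : Primrec idx := Primrec₂.natPair.comp (Primrec.fst.comp Primrec.unpair)
    (Primrec.fst.comp (Primrec.unpair.comp (Primrec.snd.comp Primrec.unpair)))
  have hsingle : Primrec single := Primrec.encode.comp (Primrec.list_cons.comp
    (Primrec.option_getD.comp Primrec.decode (Primrec.const [])) (Primrec.const []))
  have ho : RecursiveIn A (o : ℕ →. ℕ) := by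
    refine RecursiveIn.oracle.of_eq fun n => ?_
    by_cases hn : n ∈ A <;> simp [o, hn, Part.one_def, Part.zero_def]
  have hstep : RecursiveIn A ((fun w => app (Nat.pair w (o (idx w))) : ℕ → ℕ) : ℕ →. ℕ) :=
    (RecursiveIn.of_primrec happ).comp_total
      ((RecursiveIn.of_primrec Primrec.id).pair_total (ho.comp_total (.of_primrec hidx)))
  have hrec := (RecursiveIn.of_primrec hsingle).comp_total
    ((RecursiveIn.of_primrec (Primrec.const (Encodable.encode ([] : List Bool)))).prec_total hstep)
  have ho_bit : ∀ n, decide (o n = 1) = charBool A n := by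
    intro n
    by_cases hn : n ∈ A <;> simp [o, charBool, hn]
  have hval : ∀ i m, Nat.rec (motive := fun _ => ℕ) (Encodable.encode ([] : List Bool))
      (fun y IH => app (Nat.pair (Nat.pair i (Nat.pair y IH))
        (o (idx (Nat.pair i (Nat.pair y IH)))))) m = Encodable.encode (columnSeg A i m) := by
    intro i m
    induction m with
    | zero => rfl
    | succ m ih =>
      simp only [ih]
      simp [app, idx, columnSeg, initSeg_succ, ho_bit]
  refine hrec.of_eq fun n => ?_
  simp only [hval, PFun.coe_val]
  simp [single]

theorem listMeasure_singleton_le (σ : List Bool) : listMeasure [σ] ≤ (1 / 2) ^ σ.length := by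
  unfold listMeasure
  generalize hk : ([σ].map List.length).foldr max 0 = k
  obtain rfl : k = σ.length := by simpa using hk.symm
  rw [one_div, inv_pow, div_eq_mul_inv]
  refine mul_le_of_le_one_left (by positivity) ?_
  norm_cast
  refine Finset.card_le_one.2 fun v hv w hw => ?_
  simp only [Finset.mem_filter, Finset.mem_univ, true_and, List.mem_singleton,
    exists_eq_left] at hv hw
  have h : List.ofFn v = List.ofFn w :=
    (hv.eq_of_length (by simp)).symm.trans (hw.eq_of_length (by simp))
  exact List.ofFn_injective h

theorem weaklyKurtzEngulfing_of_mem_coherent {A : Set ℕ} (hA : charBool A ∈ pathSet Coherent) :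
    WeaklyKurtzEngulfing A := by
  refine ⟨fun i m => [columnSeg A i m], computableIn_columnSeg A, fun i m => ?_, fun x hx => ?_⟩
  · simpa [columnSeg] using listMeasure_singleton_le (columnSeg A i m)
  · obtain ⟨i, hi⟩ := exists_column_eq hA hx
    refine ⟨i, Set.mem_iInter.2 fun m => ?_⟩
    simp only [ClopSet, List.mem_singleton, Set.iUnion_iUnion_eq_left]
    intro k hk
    rw [columnSeg, length_initSeg] at hk
    rw [columnSeg, getD_initSeg hk, hi]

/-- there is an oracle of hyperimmune-free degree that is weakly Kurtz
engulfing. -/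
theorem stmt7 : ∃ A : Set ℕ, HyperimmuneFree A ∧ WeaklyKurtzEngulfing A := by
  obtain ⟨A, hA, hfree⟩ :=
    exists_hyperimmuneFree_mem_pathSet primrecPred_coherent nonempty_pathSet_coherent
  exact ⟨A, hfree, weaklyKurtzEngulfing_of_mem_coherent hA⟩

end CichonAnalog
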